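/- There is no symmetry (selfadjoint involution) J of dimension strictly less than 2p−2 such that every selfadjoint complex p×p matrix A with zero diagonal admits a factorization A = B J B* for some matrix B. Equivalently, 2p−2 is the minimal dimension of such a universal symmetry J. -/

import Mathlib

open Matrix

lemma quad_aux {p q : ℕ} (J : Matrix (Fin q) (Fin q) ℂ) (B : Matrix (Fin p) (Fin q) ℂ)
    (x : Fin p → ℂ) :
    star x ⬝ᵥ ((B * J * Bᴴ) *ᵥ x) = star (Bᴴ *ᵥ x) ⬝ᵥ (J *ᵥ (Bᴴ *ᵥ x)) := by
  rw [star_mulVec, conjTranspose_conjTranspose, ← dotProduct_mulVec, mulVec_mulVec, mulVec_mulVec,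
    Matrix.mul_assoc]

lemma mulVec_aux {p : ℕ} (x : Fin p → ℂ) (hx : ∑ i, x i = 0) :
    ((Matrix.of fun _ _ => (1 : ℂ)) - 1 : Matrix (Fin p) (Fin p) ℂ) *ᵥ x = -x := by
  rw [sub_mulVec, one_mulVec]
  ext i
  simp [mulVec, dotProduct, hx]

open scoped ComplexOrder in
lemma zero_aux {p : ℕ} (x y : Fin p → ℂ) (e2 : star y ⬝ᵥ y = -(star x ⬝ᵥ x)) :
    x = 0 ∧ y = 0 := by
  have px : 0 ≤ star x ⬝ᵥ x := dotProduct_star_self_nonneg x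
  have py : 0 ≤ star y ⬝ᵥ y := dotProduct_star_self_nonneg y
  have hx : star x ⬝ᵥ x = 0 := by
    apply le_antisymm _ px
    rw [e2] at py
    exact neg_nonneg.mp py
  have hy : star y ⬝ᵥ y = 0 := by rw [e2, hx, neg_zero]
  exact ⟨dotProduct_star_self_eq_zero.mp hx, dotProduct_star_self_eq_zero.mp hy⟩

/-- `2p - 2` is the minimal dimension of a universal symmetry: if `J` is a symmetry
(`J = J* = J⁻¹`) of dimension `q` such that every selfadjoint complex `p × p` matrix `A`
with zero diagonal admits a factorization `A = B J B*`, then `q ≥ 2p - 2`. -/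
theorem stmt10 (p q : ℕ) (J : Matrix (Fin q) (Fin q) ℂ)
    (hJ : J.IsHermitian) (hJ2 : J * J = 1)
    (huniv : ∀ A : Matrix (Fin p) (Fin p) ℂ, A.IsHermitian → (∀ k, A k k = 0) →
      ∃ B : Matrix (Fin p) (Fin q) ℂ, A = B * J * Bᴴ) :
    2 * p - 2 ≤ q := by
  have hA : ((Matrix.of fun _ _ => (1 : ℂ)) - 1 : Matrix (Fin p) (Fin p) ℂ).IsHermitian := by
    apply IsHermitian.sub _ isHermitian_one
    ext i j
    simp
  obtain ⟨B, hB⟩ := huniv _ hA (by intro k; simp)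
  obtain ⟨C, hC⟩ := huniv _ hA.neg (by intro k; simp)
  let s : (Fin p → ℂ) →ₗ[ℂ] ℂ := ∑ i, LinearMap.proj i
  let f : ((Fin p → ℂ) × (Fin p → ℂ)) →ₗ[ℂ] ((Fin q → ℂ) × (ℂ × ℂ)) :=
    LinearMap.prod
      (LinearMap.coprod (Matrix.mulVecLin Bᴴ) (-Matrix.mulVecLin Cᴴ)) (LinearMap.prodMap s s)
  have hf : Function.Injective f := by
    rw [injective_iff_map_eq_zero]
    rintro ⟨x, y⟩ h
    simp [f, s] at h
    obtain ⟨h1, h2, h3⟩ := h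
    have h1 : Bᴴ *ᵥ x = Cᴴ *ᵥ y := by
      rw [← sub_eq_zero, sub_eq_add_neg]; exact h1
    have e1 := quad_aux J B x
    have e2 := quad_aux J C y
    rw [← hB, mulVec_aux x h2] at e1
    rw [← hC, neg_mulVec, mulVec_aux y h3, neg_neg, ← h1, ← e1, dotProduct_neg] at e2
    obtain ⟨hx, hy⟩ := zero_aux x y e2
    rw [hx, hy]; rfl
  have := LinearMap.finrank_le_finrank_of_injective hf
  simp at this
  omega
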